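/- arXiv:2407.20165 — 3 statements merged into one kernel-verified Lean document; each statement's English description precedes it below -/
import Mathlib

section
/- Let n, d be positive integers, a ∈ ℝ^d, and let q, q_r : ℝ → ℝ^n be twice continuously differentiable with tracking error q̃ = q − q_r. Let Λ, K ∈ ℝ^{n×n} and P ∈ ℝ^{d×d} be symmetric positive definite, and define the sliding variable s(t) = q̃'(t) + Λ q̃(t). Let M : ℝ → ℝ^{n×n} be continuously differentiable with each M(t) symmetric and m_1‖v‖² ≤ vᵀM(t)v ≤ m_2‖v‖² for fixed 0 < m_1 ≤ m_2 and all t, v; let C : ℝ → ℝ^{n×n} be continuous with M'(t) − 2C(t) skew-symmetric for all t; let Y : ℝ → ℝ^{n×d} be continuous. Let ψ : ℝ^d → ℝ be twice continuously differentiable and strictly convex with ∇²ψ(Pâ(t)) invertible for all t, and let â : ℝ → ℝ^d satisfy â'(t) = P⁻¹(∇²ψ(Pâ(t)))⁻¹P⁻¹ Y(t)ᵀ s(t). Suppose M(t)s'(t) + (C(t) + K)s(t) = Y(t)(a − â(t)) for all t ≥ 0 (i.e., the feature approximation error is zero, δ = 0), and assume additionally that s' is bounded on [0, ∞). Then s(t)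 → 0, q̃(t) → 0, and q̃'(t) → 0 as t → ∞. -/
open scoped Matrix.Norms.L2Operator RealInnerProductSpace Matrix

/-- Application of a real matrix to a vector of `EuclideanSpace`. -/
noncomputable def mApp {n m : ℕ} (A : Matrix (Fin n) (Fin m) ℝ)
    (v : EuclideanSpace ℝ (Fin m)) : EuclideanSpace ℝ (Fin n) :=
  Matrix.toEuclideanLin A v

lemma aux_drop {V : ℝ → ℝ} {V' : ℝ → ℝ} {c x y : ℝ} (hxy : x ≤ y)
    (hV : ∀ t ∈ Set.Icc x y, HasDerivAt V (V' t) t)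
    (hc : ∀ t ∈ Set.Icc x y, V' t ≤ c) : V y - V x ≤ c * (y - x) := by
  refine (convex_Icc x y).image_sub_le_mul_sub_of_deriv_le
    (fun t ht => (hV t ht).continuousAt.continuousWithinAt)
    (fun t ht => (hV t (interior_subset ht)).differentiableAt.differentiableWithinAt)
    (fun t ht => ?_) x (Set.left_mem_Icc.2 hxy) y (Set.right_mem_Icc.2 hxy) hxy
  rw [(hV t (interior_subset ht)).deriv]
  exact hc t (interior_subset ht)

lemma aux_barbalat {E : Type*} [NormedAddCommGroup E] [NormedSpace ℝ E]
    {s : ℝ → E} {V V' : ℝ → ℝ} {k B : ℝ} (hk : 0 < k)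
    (hs : Differentiable ℝ s) (hB : ∀ t, 0 ≤ t → ‖deriv s t‖ ≤ B)
    (hV0 : ∀ t, 0 ≤ V t) (hV : ∀ t, 0 ≤ t → HasDerivAt V (V' t) t)
    (hV' : ∀ t, 0 ≤ t → V' t ≤ -(k * ‖s t‖ ^ 2)) :
    Filter.Tendsto s Filter.atTop (nhds 0) := by
  have hmono : ∀ x y, 0 ≤ x → x ≤ y → V y ≤ V x := by
    intro x y hx hxy
    have := aux_drop (c := 0) hxy (fun t ht => hV t (hx.trans ht.1))
      (fun t ht => (hV' t (hx.trans ht.1)).trans (by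
        have := mul_nonneg hk.le (sq_nonneg ‖s t‖); linarith))
    linarith
  have hanti : Antitone (fun t => V (max t 0)) := fun x y hxy =>
    hmono _ _ (le_max_right _ _) (max_le_max_right _ hxy)
  have hlim := tendsto_atTop_ciInf hanti ⟨0, by rintro _ ⟨t, rfl⟩; exact hV0 _⟩
  set L := ⨅ t, V (max t 0)
  have hB0 : 0 < |B| + 1 := by positivity
  rw [Metric.tendsto_atTop]
  intro ε hε
  set h : ℝ := ε / (2 * (|B| + 1)) with hh
  have hhpos : 0 < h := by positivity
  have hBh : (|B| + 1) * h = ε / 2 := by rw [hh]; field_simp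
  have hδ : 0 < k * (ε / 2) ^ 2 * h := by positivity
  obtain ⟨T, hT⟩ := Metric.tendsto_atTop.1 hlim (k * (ε / 2) ^ 2 * h / 2) (by positivity)
  refine ⟨max T 0, fun t ht => ?_⟩
  have ht0 : 0 ≤ t := (le_max_right _ _).trans ht
  have htT : T ≤ t := (le_max_left _ _).trans ht
  rw [dist_zero_right]
  by_contra hcon
  push Not at hcon
  have h1 := hT t htT
  have h2 := hT (t + h) (by linarith)
  rw [Real.dist_eq, abs_lt, max_eq_left ht0] at h1
  rw [Real.dist_eq, abs_lt, max_eq_left (by linarith : 0 ≤ t + h)] at h2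
  have hlow : ∀ τ ∈ Set.Icc t (t + h), ε / 2 ≤ ‖s τ‖ := by
    intro τ hτ
    have := (convex_Ici (0 : ℝ)).norm_image_sub_le_of_norm_deriv_le (f := s) (C := |B| + 1)
      (fun x _ => hs x) (fun x hx => (hB x hx).trans ((le_abs_self B).trans (by linarith)))
      (x := t) (y := τ) ht0 (ht0.trans hτ.1)
    have h3 : ‖τ - t‖ ≤ h := by
      rw [Real.norm_eq_abs, abs_of_nonneg (by linarith [hτ.1])]; linarith [hτ.2]
    have h4 : (|B| + 1) * ‖τ - t‖ ≤ (|B| + 1) * h := by gcongr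
    have h5 := norm_sub_norm_le (s t) (s τ)
    rw [norm_sub_rev] at h5
    linarith
  have := aux_drop (c := -(k * (ε / 2) ^ 2)) (by linarith : t ≤ t + h)
    (fun τ ht => hV τ (ht0.trans ht.1))
    (fun τ ht => (hV' τ (ht0.trans ht.1)).trans (by
        have := hlow τ ht
        gcongr))
  have h6 : t + h - t = h := by ring
  rw [h6] at this
  linarith

lemma aux_stable {W W' r : ℝ → ℝ} {l : ℝ} (hl : 0 < l) (hW0 : ∀ t, 0 ≤ W t)
    (hW : ∀ t, HasDerivAt W (W' t) t) (hW' : ∀ t, W' t ≤ -(l * W t) + r t)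
    (hr : Filter.Tendsto r Filter.atTop (nhds 0)) :
    Filter.Tendsto W Filter.atTop (nhds 0) := by
  rw [Metric.tendsto_atTop]
  intro ε hε
  have hlε : 0 < l * (ε / 2) := by positivity
  obtain ⟨T, hT⟩ := Metric.tendsto_atTop.1 hr _ hlε
  have key : ∀ t, T ≤ t →
      Real.exp (l * t) * (W t - ε / 2) ≤ Real.exp (l * T) * (W T - ε / 2) := by
    intro t ht
    have hd : ∀ x, HasDerivAt (fun x => Real.exp (l * x) * (W x - ε / 2))
        (Real.exp (l * x) * (l * 1) * (W x - ε / 2) + Real.exp (l * x) * W' x) x := fun x =>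
      (((hasDerivAt_id x).const_mul l).exp).mul ((hW x).sub_const _)
    have := aux_drop (c := 0) ht (fun x _ => hd x) (fun x hx => by
      have h1 := hT x hx.1
      rw [Real.dist_eq, sub_zero, abs_lt] at h1
      have h2 := hW' x
      have : Real.exp (l * x) * (l * 1) * (W x - ε / 2) + Real.exp (l * x) * W' x
        = Real.exp (l * x) * (l * (W x - ε / 2) + W' x) := by ring
      rw [this]
      exact mul_nonpos_of_nonneg_of_nonpos (Real.exp_pos _).le (by linarith))
    linarith
  have hexp : Filter.Tendsto (fun t => Real.exp (l * t)) Filter.atTop Filter.atTop :=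
    Real.tendsto_exp_atTop.comp (Filter.tendsto_id.const_mul_atTop hl)
  set A := Real.exp (l * T) * (W T - ε / 2)
  have hlim : Filter.Tendsto (fun t => A / Real.exp (l * t)) Filter.atTop (nhds 0) :=
    hexp.const_div_atTop A
  obtain ⟨T2, hT2⟩ := Metric.tendsto_atTop.1 hlim (ε / 2) (by positivity)
  refine ⟨max T T2, fun t ht => ?_⟩
  have h1 := key t ((le_max_left _ _).trans ht)
  have h2 := hT2 t ((le_max_right _ _).trans ht)
  rw [Real.dist_eq, sub_zero, abs_lt] at h2
  rw [Real.dist_eq, sub_zero, abs_of_nonneg (hW0 t)]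
  have h3 : W t - ε / 2 ≤ A / Real.exp (l * t) := by
    rw [le_div_iff₀ (Real.exp_pos _)]; linarith
  linarith

lemma aux_posdef {n : ℕ} (A : Matrix (Fin n) (Fin n) ℝ) (hA : A.PosDef) :
    ∃ k : ℝ, 0 < k ∧ ∀ v : EuclideanSpace ℝ (Fin n), k * ‖v‖ ^ 2 ≤ ⟪v, mApp A v⟫ := by
  have hpos : ∀ v : EuclideanSpace ℝ (Fin n), v ≠ 0 → 0 < ⟪v, mApp A v⟫ := by
    intro v hv
    have := hA.dotProduct_mulVec_pos (x := v.ofLp) (by simpa using hv)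
    rw [mApp, EuclideanSpace.inner_eq_star_dotProduct, Matrix.ofLp_toEuclideanLin_apply,
      dotProduct_comm]
    exact this
  have hcont : Continuous fun v : EuclideanSpace ℝ (Fin n) => ⟪v, mApp A v⟫ :=
    continuous_id.inner (LinearMap.continuous_of_finiteDimensional (Matrix.toEuclideanLin A))
  by_cases hne : (Metric.sphere (0 : EuclideanSpace ℝ (Fin n)) 1).Nonempty
  · obtain ⟨v0, hv0, hmin⟩ := (isCompact_sphere (0 : EuclideanSpace ℝ (Fin n)) 1).exists_isMinOn
      hne hcont.continuousOn
    have hv0' : ‖v0‖ = 1 := by simpa using hv0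
    refine ⟨_, hpos v0 (by intro h; simp [h] at hv0'), fun v => ?_⟩
    by_cases hv : v = 0
    · simp [hv]
    · have hnv : 0 < ‖v‖ := norm_pos_iff.2 hv
      have h1 : ‖v‖⁻¹ • v ∈ Metric.sphere (0 : EuclideanSpace ℝ (Fin n)) 1 := by
        simp [norm_smul, hnv.ne']
      have h2 := isMinOn_iff.1 hmin _ h1
      have h3 : ⟪‖v‖⁻¹ • v, mApp A (‖v‖⁻¹ • v)⟫ = (‖v‖ ^ 2)⁻¹ * ⟪v, mApp A v⟫ := by
        simp only [mApp, map_smul, inner_smul_left, inner_smul_right]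
        simp; ring
      rw [h3, ← div_eq_inv_mul, le_div_iff₀ (by positivity)] at h2
      exact h2
  · refine ⟨1, one_pos, fun v => ?_⟩
    have : v = 0 := by
      by_contra hv
      exact hne ⟨‖v‖⁻¹ • v, by simp [norm_smul, hv]⟩
    simp [this]

lemma aux_adj {n m : ℕ} (A : Matrix (Fin n) (Fin m) ℝ) (v : EuclideanSpace ℝ (Fin m))
    (w : EuclideanSpace ℝ (Fin n)) : ⟪mApp Aᵀ w, v⟫ = ⟪w, mApp A v⟫ := by
  have := Matrix.toEuclideanLin_conjTranspose_eq_adjoint A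
  rw [Matrix.conjTranspose_eq_transpose_of_trivial] at this
  rw [mApp, this, LinearMap.adjoint_inner_left]; rfl

lemma aux_mul {n m k : ℕ} (A : Matrix (Fin n) (Fin m) ℝ) (B : Matrix (Fin m) (Fin k) ℝ)
    (v : EuclideanSpace ℝ (Fin k)) : mApp A (mApp B v) = mApp (A * B) v := by
  simp [mApp, Matrix.toEuclideanLin_apply, Matrix.mulVec_mulVec]

lemma aux_deriv_app {n : ℕ} {M : ℝ → Matrix (Fin n) (Fin n) ℝ}
    {s : ℝ → EuclideanSpace ℝ (Fin n)} {M' : Matrix (Fin n) (Fin n) ℝ}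
    {s' : EuclideanSpace ℝ (Fin n)} {t : ℝ}
    (hM : HasDerivAt M M' t) (hs : HasDerivAt s s' t) :
    HasDerivAt (fun t => mApp (M t) (s t)) (mApp M' (s t) + mApp (M t) s') t := by
  let T : Matrix (Fin n) (Fin n) ℝ →L[ℝ]
      (EuclideanSpace ℝ (Fin n) →L[ℝ] EuclideanSpace ℝ (Fin n)) :=
    LinearMap.toContinuousLinearMap
      ((Matrix.toEuclideanCLM (n := Fin n) (𝕜 := ℝ)).toAlgEquiv.toLinearMap)
  have h := (T.hasFDerivAt.comp_hasDerivAt t hM).clm_apply hs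
  exact h

lemma aux_bregman {E : Type*} [NormedAddCommGroup E] [InnerProductSpace ℝ E] [CompleteSpace E]
    {ψ : E → ℝ} (hd : Differentiable ℝ ψ) (hc : ConvexOn ℝ Set.univ ψ) (x y : E) :
    0 ≤ ψ y - ψ x - ⟪gradient ψ x, y - x⟫ := by
  have h1 : ConvexOn ℝ Set.univ (ψ ∘ AffineMap.lineMap (k := ℝ) x y) := by
    simpa using hc.comp_affineMap (AffineMap.lineMap (k := ℝ) x y)
  have hg := (hd x).hasGradientAt.hasFDerivAt
  have hl : HasDerivAt (fun r : ℝ => AffineMap.lineMap (k := ℝ) x y r) (y - x) 0 :=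
    AffineMap.hasDerivAt_lineMap
  have h2 : HasDerivAt (ψ ∘ AffineMap.lineMap (k := ℝ) x y) ⟪gradient ψ x, y - x⟫ 0 := by
    have hg' : HasFDerivAt ψ (InnerProductSpace.toDual ℝ E (gradient ψ x))
      (AffineMap.lineMap (k := ℝ) x y (0 : ℝ)) := by simpa using hg
    simpa using hg'.comp_hasDerivAt (0 : ℝ) hl
  have h3 := h1.le_slope_of_hasDerivAt (Set.mem_univ 0) (Set.mem_univ 1) one_pos h2
  rw [slope_def_field] at h3
  simp only [Function.comp_apply, AffineMap.lineMap_apply_one, AffineMap.lineMap_apply_zero,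
    sub_zero, div_one] at h3
  linarith

lemma aux_bregman_deriv {E : Type*} [NormedAddCommGroup E] [InnerProductSpace ℝ E]
    [CompleteSpace E] {ψ : E → ℝ} (hψ : ContDiff ℝ 2 ψ) (y : E) {x : ℝ → E} {x' : E} {t : ℝ}
    (hx : HasDerivAt x x' t) :
    HasDerivAt (fun t => ψ y - ψ (x t) - ⟪gradient ψ (x t), y - x t⟫)
      (-⟪fderiv ℝ (gradient ψ) (x t) x', y - x t⟫) t := by
  have hd : Differentiable ℝ ψ := hψ.differentiable (by norm_num)
  have hgd : Differentiable ℝ (gradient ψ) := by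
    have h1 : Differentiable ℝ (fderiv ℝ ψ) :=
      (hψ.fderiv_right (m := 1) (by norm_num)).differentiable (by norm_num)
    exact (InnerProductSpace.toDual ℝ E).symm.toContinuousLinearEquiv.differentiable.comp h1
  have h1 := (hd (x t)).hasGradientAt.hasFDerivAt.comp_hasDerivAt t hx
  have h2 := (hgd (x t)).hasFDerivAt.comp_hasDerivAt t hx
  have h3 := (h1.const_sub (ψ y)).sub (h2.inner ℝ (hx.const_sub y))
  refine h3.congr_deriv ?_
  simp

/-- The `δ = 0` case of the main theorem: when the features are exact, the
mirror-descent adaptive controller achieves asymptotic tracking, i.e.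
`s(t) → 0`, `q̃(t) → 0` and `q̃'(t) → 0` as `t → ∞` (assuming additionally that
`s'` is bounded on `[0, ∞)`). -/
theorem stmt_1 {n d : ℕ} (hn : 0 < n) (hd : 0 < d)
    (a : EuclideanSpace ℝ (Fin d))
    (q qr : ℝ → EuclideanSpace ℝ (Fin n))
    (hq : ContDiff ℝ 2 q) (hqr : ContDiff ℝ 2 qr)
    (Λ K : Matrix (Fin n) (Fin n) ℝ) (P : Matrix (Fin d) (Fin d) ℝ)
    (hΛ : Λ.PosDef) (hK : K.PosDef) (hP : P.PosDef)
    (s : ℝ → EuclideanSpace ℝ (Fin n))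
    (hs : ∀ t, s t = deriv (fun τ => q τ - qr τ) t + mApp Λ (q t - qr t))
    (M : ℝ → Matrix (Fin n) (Fin n) ℝ) (hM : ContDiff ℝ 1 M)
    (hMsymm : ∀ t, (M t).IsSymm)
    (m₁ m₂ : ℝ) (hm₁ : 0 < m₁) (hm₁₂ : m₁ ≤ m₂)
    (hMbdd : ∀ (t : ℝ) (v : EuclideanSpace ℝ (Fin n)),
      m₁ * ‖v‖ ^ 2 ≤ ⟪v, mApp (M t) v⟫ ∧ ⟪v, mApp (M t) v⟫ ≤ m₂ * ‖v‖ ^ 2)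
    (C : ℝ → Matrix (Fin n) (Fin n) ℝ) (hC : Continuous C)
    (hskew : ∀ t, (deriv M t - 2 • C t)ᵀ = -(deriv M t - 2 • C t))
    (Y : ℝ → Matrix (Fin n) (Fin d) ℝ) (hY : Continuous Y)
    (ψ : EuclideanSpace ℝ (Fin d) → ℝ) (hψ : ContDiff ℝ 2 ψ)
    (hψconv : StrictConvexOn ℝ Set.univ ψ)
    (ah : ℝ → EuclideanSpace ℝ (Fin d)) (hah : Differentiable ℝ ah)
    (hHessInv : ∀ t : ℝ, IsUnit (fderiv ℝ (gradient ψ) (mApp P (ah t))))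
    (hadapt : ∀ t, deriv ah t = mApp P⁻¹
      ((Ring.inverse (fderiv ℝ (gradient ψ) (mApp P (ah t))))
        (mApp P⁻¹ (mApp (Y t)ᵀ (s t)))))
    (hdyn : ∀ t : ℝ, 0 ≤ t →
      mApp (M t) (deriv s t) + mApp (C t + K) (s t) = mApp (Y t) (a - ah t))
    (hs'bdd : ∃ B : ℝ, ∀ t : ℝ, 0 ≤ t → ‖deriv s t‖ ≤ B) :
    Filter.Tendsto s Filter.atTop (nhds 0) ∧
      Filter.Tendsto (fun t => q t - qr t) Filter.atTop (nhds 0) ∧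
      Filter.Tendsto (deriv (fun t => q t - qr t)) Filter.atTop (nhds 0) := by
  have hed : Differentiable ℝ (fun τ => q τ - qr τ) :=
    (hq.sub hqr).differentiable (by norm_num)
  have hed2 : Differentiable ℝ (deriv (fun τ => q τ - qr τ)) :=
    ((contDiff_succ_iff_deriv (n := 1)).1 (by simpa [one_add_one_eq_two] using hq.sub hqr)).2.2.differentiable
      (by norm_num)
  have hLd : ∀ {m k : ℕ} (A : Matrix (Fin m) (Fin k) ℝ) {f : ℝ → EuclideanSpace ℝ (Fin k)}
      {f' : EuclideanSpace ℝ (Fin k)} {t : ℝ}, HasDerivAt f f' t →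
      HasDerivAt (fun t => mApp A (f t)) (mApp A f') t := by
    intro m k A f f' t hf
    exact (LinearMap.toContinuousLinearMap (Matrix.toEuclideanLin A)).hasFDerivAt.comp_hasDerivAt
      t hf
  have hsd : Differentiable ℝ s := by
    have : s = fun t => deriv (fun τ => q τ - qr τ) t + mApp Λ (q t - qr t) := funext hs
    rw [this]
    intro t
    exact (hed2 t).add (hLd Λ (hed t).hasDerivAt).differentiableAt
  have hMd : Differentiable ℝ M := hM.differentiable (by norm_num)
  obtain ⟨k, hk, hkK⟩ := aux_posdef K hK
  obtain ⟨l, hl, hlΛ⟩ := aux_posdef Λ hΛ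
  obtain ⟨B, hB⟩ := hs'bdd
  have hPu : IsUnit P.det := hP.det_pos.ne'.isUnit
  have hPT : Pᵀ = P := by
    have := hP.isHermitian.eq
    rwa [Matrix.conjTranspose_eq_transpose_of_trivial] at this
  have hψd : Differentiable ℝ ψ := hψ.differentiable (by norm_num)
  have hst : Filter.Tendsto s Filter.atTop (nhds 0) := by
    refine aux_barbalat (V := fun t => (1 / 2 : ℝ) * ⟪s t, mApp (M t) (s t)⟫ +
      (ψ (mApp P a) - ψ (mApp P (ah t)) -
        ⟪gradient ψ (mApp P (ah t)), mApp P a - mApp P (ah t)⟫))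
      (V' := fun t => -⟪s t, mApp K (s t)⟫) hk hsd hB ?_ ?_ ?_
    · intro t
      have h1 := aux_bregman hψd hψconv.convexOn (mApp P (ah t)) (mApp P a)
      have h2 := (hMbdd t (s t)).1
      have h3 : 0 ≤ m₁ * ‖s t‖ ^ 2 := by positivity
      linarith
    · intro t ht
      have h1 := aux_bregman_deriv hψ (mApp P a) (hLd P (hah t).hasDerivAt)
      have h2 := (hsd t).hasDerivAt.inner ℝ
        (aux_deriv_app (hMd t).hasDerivAt (hsd t).hasDerivAt)
      refine ((h2.const_mul (1 / 2 : ℝ)).add h1).congr_deriv ?_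
      have e1 : mApp P (deriv ah t) = (Ring.inverse (fderiv ℝ (gradient ψ) (mApp P (ah t))))
          (mApp P⁻¹ (mApp (Y t)ᵀ (s t))) := by
        rw [hadapt t, aux_mul, Matrix.mul_nonsing_inv _ hPu]
        simp [mApp]
      have e2 : fderiv ℝ (gradient ψ) (mApp P (ah t)) (mApp P (deriv ah t)) =
          mApp P⁻¹ (mApp (Y t)ᵀ (s t)) := by
        rw [e1, ← ContinuousLinearMap.mul_apply, Ring.mul_inverse_cancel _ (hHessInv t)]
        rfl
      have e3 : ⟪mApp P⁻¹ (mApp (Y t)ᵀ (s t)), mApp P a - mApp P (ah t)⟫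
          = ⟪s t, mApp (Y t) (a - ah t)⟫ := by
        have : mApp P a - mApp P (ah t) = mApp P (a - ah t) := by simp [mApp]
        rw [this, ← aux_adj P, hPT, aux_mul, Matrix.mul_nonsing_inv _ hPu, ← aux_adj (Y t)]
        simp [mApp]
      rw [e2, e3, ← hdyn t ht]
      have e4 : ⟪deriv s t, mApp (M t) (s t)⟫ = ⟪s t, mApp (M t) (deriv s t)⟫ := by
        rw [← aux_adj, (hMsymm t).eq, real_inner_comm]
      have e5 : ⟪s t, mApp (deriv M t) (s t)⟫ = 2 * ⟪s t, mApp (C t) (s t)⟫ := by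
        have h := aux_adj (deriv M t - 2 • C t) (s t) (s t)
        rw [hskew t, real_inner_comm] at h
        have h' : mApp (deriv M t - 2 • C t) (s t)
            = mApp (deriv M t) (s t) - (2 : ℝ) • mApp (C t) (s t) := by
          simp [mApp, two_smul]
        have h'' : mApp (-(deriv M t - 2 • C t)) (s t)
            = -(mApp (deriv M t) (s t) - (2 : ℝ) • mApp (C t) (s t)) := by
          rw [← h']; simp only [mApp, map_neg, LinearMap.neg_apply]
        rw [h', h'', inner_neg_right, inner_sub_right, inner_smul_right] at h
        linarith
      have e6 : mApp (C t + K) (s t) = mApp (C t) (s t) + mApp K (s t) := by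
        simp [mApp]
      rw [e6]
      simp only [inner_add_right]
      rw [e4, e5]
      ring
    · intro t _
      have := hkK (s t)
      linarith
  have hde : ∀ t, deriv (fun τ => q τ - qr τ) t = s t - mApp Λ (q t - qr t) := fun t => by
    rw [hs t]; abel
  have hW : Filter.Tendsto (fun t => ‖q t - qr t‖ ^ 2) Filter.atTop (nhds 0) := by
    refine aux_stable (W := fun t => ‖q t - qr t‖ ^ 2)
      (W' := fun t => 2 * ⟪q t - qr t, deriv (fun τ => q τ - qr τ) t⟫)
      (r := fun t => ‖s t‖ ^ 2 / l) hl (fun t => by positivity)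
      (fun t => (hed t).hasDerivAt.norm_sq) (fun t => ?_) ?_
    · simp only [hde t, inner_sub_right]
      have h1 := hlΛ (q t - qr t)
      have h2 := real_inner_le_norm (q t - qr t) (s t)
      have h3 : 2 * (‖q t - qr t‖ * ‖s t‖) ≤ l * ‖q t - qr t‖ ^ 2 + ‖s t‖ ^ 2 / l := by
        have h4 : 0 ≤ (l * ‖q t - qr t‖ - ‖s t‖) ^ 2 / l := by positivity
        have h5 : (l * ‖q t - qr t‖ - ‖s t‖) ^ 2 / l =
          l * ‖q t - qr t‖ ^ 2 + ‖s t‖ ^ 2 / l - 2 * (‖q t - qr t‖ * ‖s t‖) := by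
          field_simp; ring
        linarith
      rw [← inner_sub_right, inner_sub_right]
      linarith
    · simpa using (hst.norm.pow 2).div_const l
  have he : Filter.Tendsto (fun t => q t - qr t) Filter.atTop (nhds 0) := by
    rw [tendsto_zero_iff_norm_tendsto_zero]
    simpa using hW.sqrt
  refine ⟨hst, he, ?_⟩
  have : deriv (fun t => q t - qr t) = fun t => s t - mApp Λ (q t - qr t) := funext hde
  rw [this]
  have hc := (LinearMap.continuous_of_finiteDimensional (Matrix.toEuclideanLin Λ)).tendsto 0
  have := hst.sub (hc.comp he)
  simpa [mApp] using this
end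

section
/- Let n be a positive integer, let M : ℝ → ℝ^{n×n} be differentiable with each M(t) symmetric, let C : ℝ → ℝ^{n×n}, let K ∈ ℝ^{n×n}, let s : ℝ → ℝ^n be differentiable, and let F : ℝ → ℝ^n. Suppose that for all t: (i) M'(t) − 2C(t) is skew-symmetric, and (ii) M(t)s'(t) + (C(t) + K)s(t) = F(t). Then the function t ↦ ½ s(t)ᵀ M(t) s(t) is differentiable with derivative −s(t)ᵀ K s(t) + s(t)ᵀ F(t) for every t. -/
open scoped Matrix.Norms.L2Operator RealInnerProductSpace Matrix

theorem mApp_add_left {n : ℕ} (A B : Matrix (Fin n) (Fin n) ℝ) (v : EuclideanSpace ℝ (Fin n)) :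
    mApp (A + B) v = mApp A v + mApp B v := by
  simp [mApp]

theorem mApp_sub_left {n : ℕ} (A B : Matrix (Fin n) (Fin n) ℝ) (v : EuclideanSpace ℝ (Fin n)) :
    mApp (A - B) v = mApp A v - mApp B v := by
  simp [mApp]

theorem mApp_transpose {n : ℕ} (A : Matrix (Fin n) (Fin n) ℝ) (v w : EuclideanSpace ℝ (Fin n)) :
    ⟪v, mApp Aᵀ w⟫ = ⟪w, mApp A v⟫ := by
  have h : Aᵀ = A.conjTranspose := by ext i j; simp
  rw [h, mApp, Matrix.toEuclideanLin_conjTranspose_eq_adjoint, LinearMap.adjoint_inner_right,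
    real_inner_comm, mApp]

theorem mApp_hasDerivAt {n : ℕ} {M : ℝ → Matrix (Fin n) (Fin n) ℝ}
    {s : ℝ → EuclideanSpace ℝ (Fin n)} {M' : Matrix (Fin n) (Fin n) ℝ}
    {s' : EuclideanSpace ℝ (Fin n)} {t : ℝ} (hM : HasDerivAt M M' t) (hs : HasDerivAt s s' t) :
    HasDerivAt (fun τ => mApp (M τ) (s τ)) (mApp M' (s t) + mApp (M t) s') t := by
  let L : Matrix (Fin n) (Fin n) ℝ →ₗ[ℝ] (EuclideanSpace ℝ (Fin n) →L[ℝ] EuclideanSpace ℝ (Fin n)) :=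
    (LinearMap.toContinuousLinearMap.toLinearMap).comp (Matrix.toEuclideanLin.toLinearMap)
  have hL := (LinearMap.toContinuousLinearMap L).hasFDerivAt.comp_hasDerivAt t hM
  exact hL.clm_apply hs

/-- Kinetic-energy time-derivative identity: if `M(t)` is symmetric, `M'(t) − 2C(t)` is
skew-symmetric, and `M(t)s'(t) + (C(t) + K)s(t) = F(t)` for all `t`, then
`t ↦ ½ s(t)ᵀ M(t) s(t)` has derivative `−s(t)ᵀ K s(t) + s(t)ᵀ F(t)`. -/
theorem stmt_3 {n : ℕ} (hn : 0 < n)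
    (M : ℝ → Matrix (Fin n) (Fin n) ℝ) (hM : Differentiable ℝ M)
    (hMsymm : ∀ t, (M t).IsSymm)
    (C : ℝ → Matrix (Fin n) (Fin n) ℝ) (K : Matrix (Fin n) (Fin n) ℝ)
    (s : ℝ → EuclideanSpace ℝ (Fin n)) (hs : Differentiable ℝ s)
    (F : ℝ → EuclideanSpace ℝ (Fin n))
    (hskew : ∀ t, (deriv M t - 2 • C t)ᵀ = -(deriv M t - 2 • C t))
    (hdyn : ∀ t, mApp (M t) (deriv s t) + mApp (C t + K) (s t) = F t) :
    ∀ t : ℝ, HasDerivAt (fun τ => (1 / 2 : ℝ) * ⟪s τ, mApp (M τ) (s τ)⟫)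
      (-⟪s t, mApp K (s t)⟫ + ⟪s t, F t⟫) t := by
  intro t
  have h1 := mApp_hasDerivAt (hM t).hasDerivAt (hs t).hasDerivAt
  have h2 := ((hs t).hasDerivAt.inner ℝ h1).const_mul (1 / 2 : ℝ)
  refine h2.congr_deriv ?_
  have hsk := mApp_transpose (deriv M t - 2 • C t) (s t) (s t)
  have hsym := mApp_transpose (M t) (s t) (deriv s t)
  rw [hMsymm t] at hsym
  have hneg : ∀ A : Matrix (Fin n) (Fin n) ℝ, mApp (-A) (s t) = - mApp A (s t) := by
    intro A; simp [mApp]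
  rw [hskew t, hneg, inner_neg_right, mApp_sub_left, two_smul, mApp_add_left, inner_sub_right,
    inner_add_right] at hsk
  rw [← hdyn t, mApp_add_left, inner_add_right, inner_add_right, inner_add_right]
  linarith
end

section
/- Let n, m, d be positive integers, a ∈ ℝ^d, and let Γ ∈ ℝ^{d×d} be symmetric positive definite. Let V̄ : ℝ^n × ℝ^n → ℝ be continuously differentiable, f : ℝ^n → ℝ^n, g : ℝ^n → ℝ^{n×m}, Y : ℝ^n → ℝ^{m×d}, and let x, x_r : ℝ → ℝ^n, ū : ℝ → ℝ^m, â : ℝ → ℝ^d be differentiable. Suppose for all t: (i) x'(t) = f(x(t)) + g(x(t))(ū(t) + Y(x(t))(a − â(t))) (the closed loop formed by the disturbance Y(x)a and the adaptive control u = ū − Y(x)â); and (ii) the gradient-based adaptation law â'(t) = Γ⁻¹ Y(x(t))ᵀ g(x(t))ᵀ ∇_x V̄(x(t), x_r(t)) holds. Then the function V(t) = V̄(x(t), x_r(t)) + ½ (â(t) − a)ᵀ Γ (â(t) − a) is differentiable with V'(t) = ∇_x V̄(x(t), x_r(t))ᵀ (f(x(t)) + g(x(t)) ū(t)) + ∇_{x_r}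 V̄(x(t), x_r(t))ᵀ x_r'(t), i.e., its derivative equals the derivative of V̄ along the nominal (disturbance-free) closed loop under ū. -/
open scoped Matrix.Norms.L2Operator RealInnerProductSpace Matrix

theorem mApp_adj {n m : ℕ} (A : Matrix (Fin n) (Fin m) ℝ)
    (v : EuclideanSpace ℝ (Fin n)) (w : EuclideanSpace ℝ (Fin m)) :
    ⟪v, mApp A w⟫ = ⟪mApp Aᵀ v, w⟫ := by
  unfold mApp
  rw [← Matrix.conjTranspose_eq_transpose_of_trivial, Matrix.toEuclideanLin_conjTranspose_eq_adjoint,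
    LinearMap.adjoint_inner_left]

theorem mApp_mApp_inv {d : ℕ} (A : Matrix (Fin d) (Fin d) ℝ) (hA : A.PosDef)
    (v : EuclideanSpace ℝ (Fin d)) : mApp A (mApp A⁻¹ v) = v := by
  have h : A * A⁻¹ = 1 := Matrix.mul_nonsing_inv _ ((Matrix.isUnit_iff_isUnit_det _).1 hA.isUnit)
  simp [mApp, Matrix.toLpLin_apply, Matrix.mulVec_mulVec, h]

/-- Gradient-descent adaptive control Lyapunov identity for control-affine systems:
under the closed loop `x' = f(x) + g(x)(ū + Y(x)(a − â))` and the adaptation law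
`â' = Γ⁻¹ Y(x)ᵀ g(x)ᵀ ∇ₓV̄(x, x_r)`, the augmented Lyapunov function
`V(t) = V̄(x(t), x_r(t)) + ½(â(t) − a)ᵀΓ(â(t) − a)` has derivative equal to the
derivative of `V̄` along the nominal closed loop under `ū`:
`V'(t) = ⟨∇ₓV̄, f(x) + g(x)ū⟩ + ⟨∇_{x_r}V̄, x_r'⟩`. -/
theorem stmt_11 {n m d : ℕ} (hn : 0 < n) (hm : 0 < m) (hd : 0 < d)
    (a : EuclideanSpace ℝ (Fin d))
    (Γ : Matrix (Fin d) (Fin d) ℝ) (hΓ : Γ.PosDef)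
    (Vb : EuclideanSpace ℝ (Fin n) × EuclideanSpace ℝ (Fin n) → ℝ)
    (hVb : ContDiff ℝ 1 Vb)
    (f : EuclideanSpace ℝ (Fin n) → EuclideanSpace ℝ (Fin n))
    (g : EuclideanSpace ℝ (Fin n) → Matrix (Fin n) (Fin m) ℝ)
    (Y : EuclideanSpace ℝ (Fin n) → Matrix (Fin m) (Fin d) ℝ)
    (x xr : ℝ → EuclideanSpace ℝ (Fin n)) (xr' : ℝ → EuclideanSpace ℝ (Fin n))
    (hxr : ∀ t, HasDerivAt xr (xr' t) t)
    (u : ℝ → EuclideanSpace ℝ (Fin m))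
    (ah : ℝ → EuclideanSpace ℝ (Fin d))
    (hx : ∀ t, HasDerivAt x
      (f (x t) + mApp (g (x t)) (u t + mApp (Y (x t)) (a - ah t))) t)
    (hadapt : ∀ t, HasDerivAt ah
      (mApp Γ⁻¹ (mApp (Y (x t))ᵀ (mApp (g (x t))ᵀ
        (gradient (fun z => Vb (z, xr t)) (x t))))) t) :
    ∀ t : ℝ, HasDerivAt
      (fun τ => Vb (x τ, xr τ) + (1 / 2 : ℝ) * ⟪ah τ - a, mApp Γ (ah τ - a)⟫)
      (⟪gradient (fun z => Vb (z, xr t)) (x t), f (x t) + mApp (g (x t)) (u t)⟫ +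
        ⟪gradient (fun z => Vb (x t, z)) (xr t), xr' t⟫) t := by
  intro t
  set p := gradient (fun z => Vb (z, xr t)) (x t) with hp
  set q := gradient (fun z => Vb (x t, z)) (xr t) with hq
  have hV : HasFDerivAt Vb (fderiv ℝ Vb (x t, xr t)) (x t, xr t) :=
    (hVb.differentiable (by norm_num) _).hasFDerivAt
  have h1 : ∀ v, fderiv ℝ Vb (x t, xr t) (v, 0) = ⟪p, v⟫ := by
    intro v
    have h : HasFDerivAt (fun z => Vb (z, xr t)) _ (x t) :=
      hV.comp (x t) (hasFDerivAt_prodMk_left (x t) (xr t))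
    rw [hp, gradient, InnerProductSpace.toDual_symm_apply, h.fderiv]
    simp
  have h2 : ∀ v, fderiv ℝ Vb (x t, xr t) (0, v) = ⟪q, v⟫ := by
    intro v
    have h : HasFDerivAt (fun z => Vb (x t, z)) _ (xr t) :=
      hV.comp (xr t) (hasFDerivAt_prodMk_right (x t) (xr t))
    rw [hq, gradient, InnerProductSpace.toDual_symm_apply, h.fderiv]
    simp
  have hA := hV.comp_hasDerivAt t ((hx t).prodMk (hxr t))
  have he := (hadapt t).sub_const a
  have hG : HasDerivAt (fun τ => mApp Γ (ah τ - a)) _ t :=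
    (Matrix.toEuclideanLin Γ).toContinuousLinearMap.hasFDerivAt.comp_hasDerivAt t he
  have hB := (he.inner ℝ hG).const_mul (1 / 2 : ℝ)
  have hC := hA.add hB
  have hsymm : Γᵀ = Γ := by
    rw [← Matrix.conjTranspose_eq_transpose_of_trivial]; exact hΓ.1
  refine hC.congr_deriv ?_
  have hsplit : ∀ v w : EuclideanSpace ℝ (Fin n),
      fderiv ℝ Vb (x t, xr t) (v, w) = ⟪p, v⟫ + ⟪q, w⟫ := by
    intro v w
    rw [← h1, ← h2, ← map_add]; simp
  rw [hsplit]
  have e1 : ∀ v, (LinearMap.toContinuousLinearMap (Matrix.toEuclideanLin Γ)) v = mApp Γ v :=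
    fun v => rfl
  rw [e1, mApp_mApp_inv Γ hΓ, mApp_adj Γ, hsymm, mApp_mApp_inv Γ hΓ]
  have e2 : mApp (g (x t)) (u t + mApp (Y (x t)) (a - ah t)) =
      mApp (g (x t)) (u t) - mApp (g (x t)) (mApp (Y (x t)) (ah t - a)) := by
    rw [← neg_sub (ah t) a]
    simp only [mApp, map_neg, map_add, sub_eq_add_neg]
  rw [e2, inner_add_right, inner_sub_right, inner_add_right, mApp_adj (g (x t)) p (mApp _ _),
    mApp_adj (Y (x t)), real_inner_comm (ah t - a)]
  ring
end
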